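/- (Exact recovery in the noiseless case, Corollary 2.2.) Let g be an admissible kernel with local-property constants ε, β. Then there exists a kernel-dependent separation constant ν > max(ε, β) such that for every N ∈ ℕ with N ≥ 1 and σ > 0: if x : ℤ → ℝ is summable with support K satisfying min_{k_i,k_j ∈ K, i≠j} |k_i − k_j| ≥ Nνσ, and y[k] = Σ_{j∈ℤ} g((k−j)/(σN)) x[j] (i.e., δ = 0, no noise), then the unique minimizer x̂ of Σ_k |x̃[k]| over summable x̃ with y = g_σ ∗ x̃ equals x; that is, x̂[k] = x[k] for all k ∈ ℤ. -/

import Mathlib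

/-- Definition 2 of the paper: an admissible kernel with local-property
constants `ε, β`. -/
structure IsAdmissibleKernel (g : ℝ → ℝ) (ε β : ℝ) : Prop where
  smooth : ContDiff ℝ 3 g
  even : ∀ t : ℝ, g (-t) = g t
  global_decay : ∃ C : Fin 4 → ℝ, (∀ ℓ : Fin 4, 0 < C ℓ) ∧
    ∀ (ℓ : Fin 4) (t : ℝ), |iteratedDeriv ℓ g t| ≤ C ℓ / (1 + t ^ 2)
  eps_pos : 0 < ε
  beta_pos : 0 < β
  pos_near : ∀ t : ℝ, |t| ≤ ε → 0 < g t
  max_at_eps : ∀ t : ℝ, ε < |t| → g t < g ε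
  concave_near : ∀ t : ℝ, |t| ≤ ε → iteratedDeriv 2 g t < -β

/-- The weight `1 / (1 + t ^ 2)` sampled on the grid of step `τ`. -/
noncomputable def gridWeight (τ : ℝ) (k : ℤ) : ℝ := 1 / (1 + (τ * k) ^ 2)

lemma gridWeight_pos (τ : ℝ) (k : ℤ) : 0 < gridWeight τ k := by
  unfold gridWeight; positivity

lemma gridWeight_zero (τ : ℝ) : gridWeight τ 0 = 1 := by simp [gridWeight]

lemma gridWeight_le_one (τ : ℝ) (k : ℤ) : gridWeight τ k ≤ 1 := by
  unfold gridWeight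
  rw [div_le_one (by positivity)]
  nlinarith [sq_nonneg (τ * k)]

lemma gridWeight_neg (τ : ℝ) (k : ℤ) : gridWeight τ (-k) = gridWeight τ k := by
  simp [gridWeight]

lemma one_div_one_add_sq_le {x y : ℝ} (h : |y - x| ≤ 1) :
    1 / (1 + y ^ 2) ≤ 3 * (1 / (1 + x ^ 2)) := by
  rw [mul_one_div, div_le_div_iff₀ (by positivity) (by positivity)]
  have := sq_le_one_iff_abs_le_one (y - x) |>.2 h
  nlinarith [sq_nonneg (2 * y - x), sq_nonneg y]

lemma gridWeight_add_le {τ : ℝ} {s : ℤ} (d : ℤ) (hs : |τ * s| ≤ 1) :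
    gridWeight τ (d + s) ≤ 3 * gridWeight τ d := by
  apply one_div_one_add_sq_le
  push_cast
  rwa [mul_add, add_sub_cancel_left]

lemma sum_range_gridWeight_le {τ : ℝ} (hτ : 0 < τ) (n : ℕ) :
    ∑ i ∈ Finset.range (n + 1), gridWeight τ i ≤ 1 + 2 / τ * (1 - 1 / (1 + τ * n)) := by
  induction n with
  | zero => simp [gridWeight]
  | succ n ih =>
    rw [Finset.sum_range_succ]
    have h : gridWeight τ (n + 1 : ℕ) ≤
        2 / τ * (1 / (1 + τ * n) - 1 / (1 + τ * (n + 1 : ℕ))) := by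
      have h1 : 2 / τ * (1 / (1 + τ * n) - 1 / (1 + τ * (n + 1 : ℕ))) =
          2 / ((1 + τ * n) * (1 + τ * (n + 1 : ℕ))) := by
        have : (1 + τ * n) ≠ 0 := by positivity
        have : (1 + τ * (n + 1 : ℕ)) ≠ 0 := by positivity
        field_simp
        push_cast
        ring
      rw [h1, gridWeight, div_le_div_iff₀ (by positivity) (by positivity)]
      push_cast
      nlinarith [sq_nonneg (1 - τ * (n + 1)), mul_nonneg hτ.le (Nat.cast_nonneg (α := ℝ) n)]
    calc _ ≤ _ := add_le_add ih h
      _ = _ := by ring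

lemma sum_range_gridWeight_le' {τ : ℝ} (hτ : 0 < τ) (n : ℕ) :
    ∑ i ∈ Finset.range n, gridWeight τ i ≤ 1 + 2 / τ := by
  calc _ ≤ ∑ i ∈ Finset.range (n + 1), gridWeight τ i := by
        rw [Finset.sum_range_succ]
        linarith [gridWeight_pos τ n]
    _ ≤ _ := sum_range_gridWeight_le hτ n
    _ ≤ _ := by
        have : 0 ≤ 2 / τ * (1 / (1 + τ * n)) := by positivity
        linarith

lemma summable_gridWeight_nat {τ : ℝ} (hτ : 0 < τ) : Summable fun n : ℕ => gridWeight τ n :=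
  summable_of_sum_range_le (fun n => (gridWeight_pos τ n).le) (sum_range_gridWeight_le' hτ)

lemma summable_gridWeight {τ : ℝ} (hτ : 0 < τ) : Summable (gridWeight τ) :=
  Summable.of_nat_of_neg (summable_gridWeight_nat hτ)
    (by simpa only [gridWeight_neg] using summable_gridWeight_nat hτ)

lemma tsum_gridWeight_le {τ : ℝ} (hτ : 0 < τ) : ∑' k, gridWeight τ k ≤ 4 * (1 + 1 / τ) := by
  have h := summable_gridWeight_nat hτ
  have hle : ∑' n : ℕ, gridWeight τ n ≤ 1 + 2 / τ :=
    Real.tsum_le_of_sum_range_le (fun n => (gridWeight_pos τ n).le) (sum_range_gridWeight_le' hτ)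
  have h' := HasSum.of_nat_of_neg (f := gridWeight τ) h.hasSum
    (by simpa only [gridWeight_neg] using h.hasSum)
  rw [h'.tsum_eq, gridWeight_zero]
  have : 4 * (1 + 1 / τ) = 2 * (1 + 2 / τ) + 2 := by ring
  linarith

lemma summable_gridWeight_sub {τ : ℝ} (hτ : 0 < τ) (k : ℤ) :
    Summable fun n => gridWeight τ (k - n) :=
  (summable_gridWeight hτ).comp_injective sub_right_injective

/-- The sampled weight, summed over the points of a `ν`-separated set at distance at least `ν / 2`,
is `O(1 / ν ^ 2)`. -/
lemma tsum_indicator_gridWeight_le {τ ν : ℝ} (hτ : 0 < τ) (hν : 0 < ν) {K : Set ℤ}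
    (hK : ∀ m ∈ K, ∀ n ∈ K, m ≠ n → ν ≤ |τ * ((m : ℝ) - n)|) (k : ℤ) :
    ∑' n, {n | n ∈ K ∧ ν / 2 ≤ |τ * ((k : ℝ) - n)|}.indicator
      (fun n => gridWeight τ (k - n)) n ≤ 104 / ν ^ 2 := by
  set A : Set ℤ := {n | n ∈ K ∧ ν / 2 ≤ |τ * ((k : ℝ) - n)|}
  rw [← tsum_subtype]
  let φ : A → ℤ := fun n => ⌊τ * ((n : ℤ) - (k : ℝ)) / ν⌋
  have hφ : Function.Injective φ := by
    intro m n h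
    by_contra hne
    have h1 := hK m m.2.1 n n.2.1 (fun h => hne (Subtype.ext h))
    have h2 := Int.abs_sub_lt_one_of_floor_eq_floor h
    rw [← sub_div, abs_div, abs_of_pos hν, div_lt_one hν] at h2
    have : τ * ((m : ℤ) - (k : ℝ)) - τ * ((n : ℤ) - (k : ℝ)) = τ * ((m : ℤ) - (n : ℤ)) := by ring
    rw [this] at h2
    linarith
  have hZ := summable_gridWeight one_pos
  have hle : ∀ n : A, gridWeight τ (k - n) ≤ 13 / ν ^ 2 * gridWeight 1 (φ n) := by
    intro n
    have h1 := n.2.2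
    have h2 : (φ n : ℝ) ≤ τ * ((n : ℤ) - (k : ℝ)) / ν := Int.floor_le _
    have h3 : τ * ((n : ℤ) - (k : ℝ)) / ν < φ n + 1 := Int.lt_floor_add_one _
    set d := τ * ((n : ℤ) - (k : ℝ)) / ν with hd
    have hdν : τ * ((n : ℤ) - (k : ℝ)) = d * ν := by rw [hd]; field_simp
    have h4 : τ * ((k : ℝ) - (n : ℤ)) = - (d * ν) := by rw [← hdν]; ring
    rw [h4, abs_neg, abs_mul, abs_of_pos hν] at h1
    have h5 : 1 / 2 ≤ |d| := by
      by_contra! h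
      nlinarith
    have h6 : |(φ n : ℝ)| ≤ 3 * |d| := by
      rw [abs_le]
      constructor <;> cases abs_cases d <;> linarith
    have h7 : (φ n : ℝ) ^ 2 ≤ 9 * d ^ 2 := by
      rw [← sq_abs, ← sq_abs d]
      nlinarith [abs_nonneg (φ n : ℝ)]
    have h8 : 1 ≤ 4 * d ^ 2 := by rw [← sq_abs d]; nlinarith
    unfold gridWeight
    push_cast
    rw [h4, div_mul_div_comm, div_le_div_iff₀ (by positivity) (by positivity)]
    nlinarith [mul_le_mul_of_nonneg_left (add_le_add h8 h7) (sq_nonneg ν)]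
  have hs1 : Summable fun n : A => gridWeight τ (k - n) :=
    (summable_gridWeight_sub hτ k).subtype A
  have hs2 : Summable fun n : A => gridWeight 1 (φ n) := hZ.comp_injective hφ
  calc _ ≤ ∑' n : A, 13 / ν ^ 2 * gridWeight 1 (φ n) := hs1.tsum_le_tsum hle (hs2.mul_left _)
    _ = 13 / ν ^ 2 * ∑' n : A, gridWeight 1 (φ n) := tsum_mul_left
    _ ≤ 13 / ν ^ 2 * 8 := by
        gcongr
        calc _ ≤ ∑' i, gridWeight 1 i :=
              tsum_comp_le_tsum_of_inj hZ (fun i => (gridWeight_pos 1 i).le) hφ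
          _ ≤ _ := by have := tsum_gridWeight_le one_pos; norm_num at this ⊢; exact this
    _ = _ := by ring

/-- Sampled kernels `p`, `e` with (discrete) derivatives `p₁`, `e₁`, suited to Hermite interpolation
of sign patterns on the grid of step `τ`. -/
structure InterpolationKernel (τ C c : ℝ) (p p₁ e e₁ : ℤ → ℝ) : Prop where
  abs_p_le : ∀ k, |p k| ≤ C * gridWeight τ k
  abs_p₁_le : ∀ k, |p₁ k| ≤ C * gridWeight τ k
  abs_e_le : ∀ k, |e k| ≤ C * gridWeight τ k
  abs_e₁_le : ∀ k, |e₁ k| ≤ C * gridWeight τ k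
  p_zero : p 0 = 1
  p₁_zero : p₁ 0 = 0
  e_zero : e 0 = 0
  e₁_zero : e₁ 0 = 1
  taylor_p : ∀ d s : ℤ, |τ * s| ≤ 1 →
    |p (d + s) - p d - τ * s * p₁ d| ≤ C * (τ * s) ^ 2 * gridWeight τ d
  taylor_e : ∀ d s : ℤ, |τ * s| ≤ 1 →
    |e (d + s) - e d - τ * s * e₁ d| ≤ C * (τ * s) ^ 2 * gridWeight τ d
  gap : ∀ s : ℤ, |p s| ≤ 1 - c * min 1 ((τ * s) ^ 2)

/-- The points of `K` at distance at least `ν / 2` from `k`, on the grid of step `τ`. -/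
def farPoints (τ ν : ℝ) (K : Set ℤ) (k : ℤ) : Set ℤ :=
  {n | n ∈ K ∧ ν / 2 ≤ |τ * ((k : ℝ) - n)|}

section FarSums

variable {τ ν : ℝ} {K : Set ℤ}

lemma summable_farPoints (hτ : 0 < τ) {k : ℤ} {D : ℝ} {F : ℤ → ℝ}
    (hF : ∀ n ∈ farPoints τ ν K k, |F n| ≤ D * gridWeight τ (k - n)) :
    Summable ((farPoints τ ν K k).indicator F) := by
  refine Summable.of_norm_bounded
    (g := (farPoints τ ν K k).indicator fun n => D * gridWeight τ (k - n))
    (((summable_gridWeight_sub hτ k).mul_left D).indicator _) fun n => ?_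
  by_cases hn : n ∈ farPoints τ ν K k
  · simpa [hn] using hF n hn
  · simp [hn]

lemma abs_tsum_farPoints_le (hτ : 0 < τ) (hν : 0 < ν)
    (hK : ∀ m ∈ K, ∀ n ∈ K, m ≠ n → ν ≤ |τ * ((m : ℝ) - n)|)
    {k : ℤ} {D : ℝ} (hD : 0 ≤ D) {F : ℤ → ℝ}
    (hF : ∀ n ∈ farPoints τ ν K k, |F n| ≤ D * gridWeight τ (k - n)) :
    |∑' n, (farPoints τ ν K k).indicator F n| ≤ D * (104 / ν ^ 2) := by
  have hs := ((summable_gridWeight_sub hτ k).indicator (farPoints τ ν K k)).mul_left D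
  calc _ ≤ ∑' n, D * (farPoints τ ν K k).indicator (fun n => gridWeight τ (k - n)) n := by
        rw [← Real.norm_eq_abs]
        refine tsum_of_norm_bounded hs.hasSum fun n => ?_
        by_cases hn : n ∈ farPoints τ ν K k
        · simpa [hn] using hF n hn
        · simp [hn]
    _ = D * ∑' n, (farPoints τ ν K k).indicator (fun n => gridWeight τ (k - n)) n := tsum_mul_left
    _ ≤ _ := mul_le_mul_of_nonneg_left (tsum_indicator_gridWeight_le hτ hν hK k) hD

lemma farPoints_of_near
    (hK : ∀ m ∈ K, ∀ n ∈ K, m ≠ n → ν ≤ |τ * ((m : ℝ) - n)|)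
    {k m : ℤ} (hm : m ∈ K) (hkm : |τ * ((k : ℝ) - m)| < ν / 2) :
    farPoints τ ν K k = K \ {m} := by
  ext n
  simp only [farPoints, Set.mem_ofPred_eq, Set.mem_sdiff, Set.mem_singleton_iff]
  refine and_congr_right fun hn => ⟨?_, ?_⟩
  · rintro h rfl
    linarith
  · intro hne
    have h := hK n hn m hm hne
    have h2 : τ * ((n : ℝ) - m) = τ * ((k : ℝ) - m) - τ * ((k : ℝ) - n) := by ring
    rw [h2] at h
    linarith [abs_sub (τ * ((k : ℝ) - m)) (τ * ((k : ℝ) - n))]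

end FarSums

section Certificate

variable {τ C c : ℝ} {p p₁ e e₁ : ℤ → ℝ}

lemma abs_mul_add_mul_le {a b x y D E : ℝ} (ha : |a| ≤ D) (hb : |b| ≤ D) (hx : |x| ≤ E)
    (hy : |y| ≤ E) : |a * x + b * y| ≤ 2 * D * E := by
  have hD := (abs_nonneg a).trans ha
  calc _ ≤ |a * x| + |b * y| := abs_add_le _ _
    _ ≤ D * E + D * E := by
      rw [abs_mul, abs_mul]
      gcongr
    _ = _ := by ring

open scoped BoundedContinuousFunction in
/-- The Hermite interpolation system on a well separated set is solvable with bounded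
coefficients. -/
lemma InterpolationKernel.exists_coeff (h : InterpolationKernel τ C c p p₁ e e₁) (hτ : 0 < τ)
    (hC : 0 ≤ C) {ν : ℝ} (hν : 0 < ν) (hνC : C * (104 / ν ^ 2) ≤ 1 / 8) {K : Set ℤ}
    (hK : ∀ m ∈ K, ∀ n ∈ K, m ≠ n → ν ≤ |τ * ((m : ℝ) - n)|) {u : ℤ → ℝ} (hu : ∀ m, |u m| ≤ 1) :
    ∃ a b : ℤ → ℝ, (∀ n, |a n| ≤ 2) ∧ (∀ n, |b n| ≤ 2) ∧ (∀ n ∉ K, a n = 0 ∧ b n = 0) ∧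
      ∀ m ∈ K,
        a m = u m - ∑' n, (farPoints τ ν K m).indicator
          (fun n => a n * p (m - n) + b n * e (m - n)) n ∧
        b m = - ∑' n, (farPoints τ ν K m).indicator
          (fun n => a n * p₁ (m - n) + b n * e₁ (m - n)) n := by
  classical
  let S (x y : ℤ → ℝ) (v : ℤ → ℝ × ℝ) (m : ℤ) : ℝ := ∑' n, (farPoints τ ν K m).indicator
    (fun n => (v n).1 * x (m - n) + (v n).2 * y (m - n)) n
  let Ψ (v : ℤ → ℝ × ℝ) (m : ℤ) : ℝ × ℝ :=
    if m ∈ K then (u m - S p e v m, - S p₁ e₁ v m) else 0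
  have hpt {x y : ℤ → ℝ} (hx : ∀ k, |x k| ≤ C * gridWeight τ k)
      (hy : ∀ k, |y k| ≤ C * gridWeight τ k) {v : ℤ → ℝ × ℝ} {D : ℝ} (hv : ∀ n, ‖v n‖ ≤ D)
      (m n : ℤ) : |(v n).1 * x (m - n) + (v n).2 * y (m - n)| ≤
        (2 * D * C) * gridWeight τ (m - n) := by
    rw [mul_assoc (2 * D)]
    exact abs_mul_add_mul_le ((norm_fst_le _).trans (hv n)) ((norm_snd_le _).trans (hv n))
      (hx _) (hy _)
  have hS {x y : ℤ → ℝ} (hx : ∀ k, |x k| ≤ C * gridWeight τ k)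
      (hy : ∀ k, |y k| ≤ C * gridWeight τ k) {v : ℤ → ℝ × ℝ} {D : ℝ} (hv : ∀ n, ‖v n‖ ≤ D)
      (m : ℤ) : |S x y v m| ≤ D / 4 := by
    have hD : 0 ≤ D := (norm_nonneg _).trans (hv 0)
    refine (abs_tsum_farPoints_le hτ hν hK (by positivity)
      (fun n _ => hpt hx hy hv m n)).trans ?_
    nlinarith
  have hSsub {x y : ℤ → ℝ} (hx : ∀ k, |x k| ≤ C * gridWeight τ k)
      (hy : ∀ k, |y k| ≤ C * gridWeight τ k) {v w : ℤ → ℝ × ℝ} {D E : ℝ} (hv : ∀ n, ‖v n‖ ≤ D)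
      (hw : ∀ n, ‖w n‖ ≤ E) (m : ℤ) : S x y v m - S x y w m = S x y (v - w) m := by
    rw [← Summable.tsum_sub (summable_farPoints hτ fun n _ => hpt hx hy hv m n)
      (summable_farPoints hτ fun n _ => hpt hx hy hw m n)]
    refine tsum_congr fun n => ?_
    by_cases hn : n ∈ farPoints τ ν K m
    · simp only [hn, Set.indicator_of_mem, Pi.sub_apply, Prod.fst_sub, Prod.snd_sub]
      ring
    · simp [hn]
  have hΨ (v : ℤ → ℝ × ℝ) (D : ℝ) (hv : ∀ n, ‖v n‖ ≤ D) (m : ℤ) : ‖Ψ v m‖ ≤ 1 + D / 4 := by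
    have hD : 0 ≤ D := (norm_nonneg _).trans (hv 0)
    have h1 := hS h.abs_p_le h.abs_e_le hv m
    have h2 := hS h.abs_p₁_le h.abs_e₁_le hv m
    simp only [Ψ]
    split_ifs
    · rw [Prod.norm_def, sup_le_iff]
      constructor
      · exact (abs_sub _ _).trans (add_le_add (hu m) h1)
      · simp only [Real.norm_eq_abs, abs_neg]
        linarith
    · simp only [norm_zero]
      positivity
  let Φ (v : ℤ →ᵇ ℝ × ℝ) : ℤ →ᵇ ℝ × ℝ := BoundedContinuousFunction.ofNormedAddCommGroupDiscrete
    (Ψ v) (1 + ‖v‖ / 4) (hΨ v ‖v‖ v.norm_coe_le_norm)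
  have hΦ (v : ℤ →ᵇ ℝ × ℝ) (m : ℤ) : Φ v m = Ψ v m := rfl
  have hcontr : ContractingWith (1 / 2) Φ := by
    refine ⟨by norm_num [← NNReal.coe_lt_coe], LipschitzWith.of_dist_le_mul fun v w => ?_⟩
    rw [BoundedContinuousFunction.dist_le (by positivity)]
    intro m
    rw [hΦ, hΦ, dist_eq_norm, dist_eq_norm]
    have hvw : ∀ n, ‖((v : ℤ → ℝ × ℝ) - w) n‖ ≤ ‖v - w‖ := (v - w).norm_coe_le_norm
    have h1 := hS h.abs_p_le h.abs_e_le hvw m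
    have h2 := hS h.abs_p₁_le h.abs_e₁_le hvw m
    rw [← hSsub h.abs_p_le h.abs_e_le v.norm_coe_le_norm w.norm_coe_le_norm] at h1
    rw [← hSsub h.abs_p₁_le h.abs_e₁_le v.norm_coe_le_norm w.norm_coe_le_norm] at h2
    have h0 := norm_nonneg (v - w)
    have hc : ((1 / 2 : NNReal) : ℝ) = 1 / 2 := by norm_num
    rw [hc]
    simp only [Ψ]
    split_ifs
    · rw [Prod.mk_sub_mk, Prod.norm_def, sup_le_iff]
      simp only [Real.norm_eq_abs]
      constructor
      · rw [sub_sub_sub_cancel_left, abs_sub_comm]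
        linarith
      · rw [neg_sub_neg, abs_sub_comm]
        linarith
    · simp only [sub_zero, norm_zero]
      positivity
  obtain ⟨v, hv⟩ : ∃ v, Φ v = v := ⟨_, hcontr.fixedPoint_isFixedPt⟩
  have hv' (m : ℤ) : v m = Ψ v m := by rw [← hΦ, hv]
  have hnorm : ‖v‖ ≤ 2 := by
    have : ‖v‖ ≤ 1 + ‖v‖ / 4 := by
      rw [BoundedContinuousFunction.norm_le (by positivity)]
      intro m
      rw [hv']
      exact hΨ v ‖v‖ v.norm_coe_le_norm m
    linarith
  have hvn (n : ℤ) : ‖v n‖ ≤ 2 := (v.norm_coe_le_norm n).trans hnorm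
  refine ⟨fun n => (v n).1, fun n => (v n).2, fun n => (norm_fst_le _).trans (hvn n),
    fun n => (norm_snd_le _).trans (hvn n), fun n hn => ?_, fun m hm => ?_⟩
  · simp [hv' n, Ψ, hn]
  · have := hv' m
    simp only [Ψ, hm, if_true] at this
    exact ⟨congrArg Prod.fst this, congrArg Prod.snd this⟩

lemma exists_separation_le {C δ : ℝ} (hδ : 0 < δ) :
    ∃ ν₀ : ℝ, 2 ≤ ν₀ ∧ ∀ ν, ν₀ ≤ ν → C * (104 / ν ^ 2) ≤ δ := by
  refine ⟨max 2 (104 * C / δ), le_max_left _ _, fun ν hν => ?_⟩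
  have h1 : 2 ≤ ν := (le_max_left _ _).trans hν
  have h2 : 104 * C / δ ≤ ν := (le_max_right _ _).trans hν
  rw [div_le_iff₀ hδ] at h2
  rw [mul_div_assoc', div_le_iff₀ (by positivity)]
  nlinarith [mul_pos (show 0 < ν by linarith) hδ]

/-- A dual certificate: every sign pattern on a well separated set `K` is interpolated by a bounded
combination of translates of `p` and `e` which is strictly less than `1` in modulus off `K`. -/
theorem InterpolationKernel.exists_certificate {C c : ℝ} (hc : 0 < c) :
    ∃ ν₀ : ℝ, ∀ ν, ν₀ ≤ ν → ∀ τ : ℝ, 0 < τ → ∀ p p₁ e e₁ : ℤ → ℝ,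
      InterpolationKernel τ C c p p₁ e e₁ → ∀ K : Set ℤ,
      (∀ m ∈ K, ∀ n ∈ K, m ≠ n → ν ≤ |τ * ((m : ℝ) - n)|) →
      ∀ u : ℤ → ℝ, (∀ m, |u m| ≤ 1) →
      ∃ a b : ℤ → ℝ, (∀ n, |a n| ≤ 2) ∧ (∀ n, |b n| ≤ 2) ∧
        (∀ m ∈ K, ∑' n, (a n * p (m - n) + b n * e (m - n)) = u m) ∧
        ∀ k ∉ K, |∑' n, (a n * p (k - n) + b n * e (k - n))| < 1 := by
  obtain ⟨ν₀, hν₀, hν₀C⟩ := exists_separation_le (C := C) (δ := min (1 / 8) (c / (16 * (|C| + 1))))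
    (by positivity)
  refine ⟨ν₀, fun ν hν τ hτ p p₁ e e₁ h K hK u hu => ?_⟩
  have hν2 : 2 ≤ ν := hν₀.trans hν
  have hνpos : 0 < ν := by linarith
  have hC : 1 ≤ C := by
    have := h.abs_p_le 0
    rw [h.p_zero, gridWeight_zero] at this
    simpa using this
  have hθ := hν₀C ν hν
  set θ := C * (104 / ν ^ 2) with hθdef
  have hθ8 : θ ≤ 1 / 8 := hθ.trans (min_le_left _ _)
  have hθ0 : 0 ≤ θ := by positivity
  have hθc : θ * (16 * (C + 1)) ≤ c := by
    have := hθ.trans (min_le_right _ _)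
    rwa [abs_of_pos (by linarith), le_div_iff₀ (by positivity)] at this
  obtain ⟨a, b, ha, hb, hab, hsys⟩ := h.exists_coeff hτ (by linarith) hνpos hθ8 hK hu
  have hpt {x y : ℤ → ℝ} (hx : ∀ k, |x k| ≤ C * gridWeight τ k)
      (hy : ∀ k, |y k| ≤ C * gridWeight τ k) (m n : ℤ) :
      |a n * x (m - n) + b n * y (m - n)| ≤ (4 * C) * gridWeight τ (m - n) := by
    refine (abs_mul_add_mul_le (ha n) (hb n) (hx _) (hy _)).trans (le_of_eq ?_)
    ring
  have hfar {x y : ℤ → ℝ} (hx : ∀ k, |x k| ≤ C * gridWeight τ k)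
      (hy : ∀ k, |y k| ≤ C * gridWeight τ k) (m : ℤ) :
      |∑' n, (farPoints τ ν K m).indicator (fun n => a n * x (m - n) + b n * y (m - n)) n|
        ≤ 4 * θ := by
    refine (abs_tsum_farPoints_le hτ hνpos hK (by positivity)
      fun n _ => hpt hx hy m n).trans (le_of_eq ?_)
    rw [hθdef]
    ring
  have hsum (k : ℤ) : Summable fun n => a n * p (k - n) + b n * e (k - n) :=
    Summable.of_norm_bounded ((summable_gridWeight_sub hτ k).mul_left (4 * C))
      fun n => hpt h.abs_p_le h.abs_e_le k n
  have hnear {k m : ℤ} (hm : m ∈ K) (hkm : |τ * ((k : ℝ) - m)| < ν / 2) :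
      ∑' n, (a n * p (k - n) + b n * e (k - n)) = (a m * p (k - m) + b m * e (k - m)) +
        ∑' n, (farPoints τ ν K k).indicator (fun n => a n * p (k - n) + b n * e (k - n)) n := by
    rw [(hsum k).tsum_eq_add_tsum_ite m, farPoints_of_near hK hm hkm]
    congr 1
    refine tsum_congr fun n => ?_
    by_cases hn : n = m
    · simp [hn]
    · by_cases hnK : n ∈ K
      · simp [hn, hnK]
      · simp [hn, hnK, hab n hnK]
  refine ⟨a, b, ha, hb, fun m hm => ?_, fun k hk => ?_⟩
  · rw [hnear hm (by simpa using half_pos hνpos), sub_self, h.p_zero, h.e_zero, (hsys m hm).1]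
    ring
  by_cases hex : ∃ m ∈ K, |τ * ((k : ℝ) - m)| < ν / 2
  swap
  · push Not at hex
    have heq : ∑' n, (a n * p (k - n) + b n * e (k - n)) =
        ∑' n, (farPoints τ ν K k).indicator (fun n => a n * p (k - n) + b n * e (k - n)) n := by
      refine tsum_congr fun n => ?_
      by_cases hn : n ∈ K
      · rw [Set.indicator_of_mem (show n ∈ farPoints τ ν K k from ⟨hn, hex n hn⟩)]
      · simp [farPoints, hn, hab n hn]
    rw [heq]
    linarith [hfar h.abs_p_le h.abs_e_le k]
  obtain ⟨m, hm, hkm⟩ := hex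
  rw [hnear hm hkm]
  obtain ⟨s, rfl⟩ : ∃ s, k = m + s := ⟨k - m, by ring⟩
  have hs0 : s ≠ 0 := by
    rintro rfl
    exact hk (by simpa using hm)
  have hs0' : 0 < (τ * s) ^ 2 := by positivity
  have hkm' : τ * (((m + s : ℤ) : ℝ) - m) = τ * s := by push_cast; ring
  rw [hkm'] at hkm
  rw [add_sub_cancel_left]
  have hmm : |τ * ((m : ℝ) - m)| < ν / 2 := by simpa using half_pos hνpos
  obtain ⟨h1, h2⟩ := hsys m hm
  have haθ : |u m - a m| ≤ 4 * θ := by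
    rw [h1, sub_sub_cancel]
    exact hfar h.abs_p_le h.abs_e_le m
  have hbθ : |b m| ≤ 4 * θ := by
    rw [h2, abs_neg]
    exact hfar h.abs_p₁_le h.abs_e₁_le m
  have hgap := h.gap s
  rcases le_or_gt |τ * s| 1 with hs1 | hs1
  · have hsq : (τ * s) ^ 2 ≤ 1 := (sq_le_one_iff_abs_le_one _).2 hs1
    rw [min_eq_right hsq] at hgap
    have hp := h.taylor_p 0 s hs1
    have he := h.taylor_e 0 s hs1
    rw [zero_add, h.p_zero, h.p₁_zero, gridWeight_zero, mul_zero, sub_zero, mul_one] at hp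
    rw [zero_add, h.e_zero, h.e₁_zero, gridWeight_zero, sub_zero, mul_one, mul_one] at he
    set R := ∑' n, (farPoints τ ν K m).indicator
      (fun n => a n * (p (m - n + s) - p (m - n) - τ * s * p₁ (m - n)) +
        b n * (e (m - n + s) - e (m - n) - τ * s * e₁ (m - n))) n with hR
    have hRle : |R| ≤ 4 * θ * (τ * s) ^ 2 := by
      refine (abs_tsum_farPoints_le (D := 4 * (C * (τ * s) ^ 2)) hτ hνpos hK (by positivity)
        fun n _ => ?_).trans (le_of_eq ?_)
      · refine (abs_mul_add_mul_le (ha n) (hb n) (h.taylor_p _ s hs1)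
          (h.taylor_e _ s hs1)).trans (le_of_eq ?_)
        ring
      · rw [hθdef]
        ring
    have hfareq : farPoints τ ν K (m + s) = farPoints τ ν K m := by
      rw [farPoints_of_near hK hm hmm, farPoints_of_near hK hm (by rwa [hkm'])]
    have hReq : ∑' n, (farPoints τ ν K (m + s)).indicator
        (fun n => a n * p (m + s - n) + b n * e (m + s - n)) n =
        (u m - a m) + τ * s * (- b m) + R := by
      have e1 := sub_eq_iff_eq_add'.2 (sub_eq_iff_eq_add.1 h1.symm)
      have e2 := neg_eq_iff_eq_neg.2 h2
      have s1 := summable_farPoints (ν := ν) (K := K) hτ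
        fun n _ => hpt h.abs_p_le h.abs_e_le m n
      have s2 := summable_farPoints (ν := ν) (K := K) hτ
        fun n _ => hpt h.abs_p₁_le h.abs_e₁_le m n
      have s3 : Summable ((farPoints τ ν K m).indicator
          (fun n => a n * p (m + s - n) + b n * e (m + s - n))) := (hsum _).indicator _
      rw [e1, e2, ← sub_eq_iff_eq_add', hR, ← tsum_mul_left, ← s1.tsum_add (s2.mul_left _), hfareq,
        ← s3.tsum_sub (s1.add (s2.mul_left _))]
      refine tsum_congr fun n => ?_
      by_cases hn : n ∈ farPoints τ ν K m
      · simp only [hn, Set.indicator_of_mem]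
        rw [show m + s - n = m - n + s by ring]
        ring
      · simp [hn]
    rw [hReq]
    have key : a m * p s + b m * e s + ((u m - a m) + τ * s * (- b m) + R) =
        u m * p s + (u m - a m) * (-(p s - 1)) + b m * (e s - τ * s) + R := by ring
    rw [key]
    have t1 : |u m * p s| ≤ |p s| := by
      rw [abs_mul]
      exact mul_le_of_le_one_left (abs_nonneg _) (hu m)
    have t2 : |(u m - a m) * (-(p s - 1))| ≤ 4 * θ * (C * (τ * s) ^ 2) := by
      rw [abs_mul, abs_neg]
      gcongr
    have t3 : |b m * (e s - τ * s)| ≤ 4 * θ * (C * (τ * s) ^ 2) := by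
      rw [abs_mul]
      gcongr
    have t4 := abs_add_le (u m * p s + (u m - a m) * (-(p s - 1)) + b m * (e s - τ * s)) R
    have t5 := abs_add_three (u m * p s) ((u m - a m) * (-(p s - 1))) (b m * (e s - τ * s))
    have t6 : (4 * θ * (2 * C + 1)) * (τ * s) ^ 2 < c * (τ * s) ^ 2 := by
      refine mul_lt_mul_of_pos_right ?_ hs0'
      nlinarith
    nlinarith
  · have hsq : 1 ≤ (τ * s) ^ 2 := (one_le_sq_iff_one_le_abs _).2 hs1.le
    rw [min_eq_left hsq, mul_one] at hgap
    have key : a m * p s + b m * e s = u m * p s + (-(u m - a m)) * p s + b m * e s := by ring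
    have t1 : |u m * p s| ≤ |p s| := by
      rw [abs_mul]
      exact mul_le_of_le_one_left (abs_nonneg _) (hu m)
    have t2 : |(-(u m - a m)) * p s| ≤ 4 * θ * 1 := by
      rw [abs_mul, abs_neg]
      gcongr
      linarith
    have t3 : |b m * e s| ≤ 4 * θ * C := by
      have : |e s| ≤ C := (h.abs_e_le s).trans
        (mul_le_of_le_one_right (by linarith) (gridWeight_le_one _ _))
      rw [abs_mul]
      gcongr
    have t4 := hfar h.abs_p_le h.abs_e_le (m + s)
    have t5 := abs_add_three (u m * p s) ((-(u m - a m)) * p s) (b m * e s)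
    rw [key]
    have t6 : 4 * θ * (C + 2) < c := by nlinarith
    refine (abs_add_le _ _).trans_lt ?_
    linarith

end Certificate

/-- The correlation `k ↦ ∑ j, x j * y (j + k)` of two sequences. -/
noncomputable def gridCorr (x y : ℤ → ℝ) (k : ℤ) : ℝ := ∑' j, x j * y (j + k)

section Correlation

variable {τ A B : ℝ} {x y : ℤ → ℝ}

lemma gridWeight_mul_gridWeight_le (τ : ℝ) (j k : ℤ) :
    gridWeight τ j * gridWeight τ (j + k) ≤
      2 * gridWeight τ k * (gridWeight τ j + gridWeight τ (j + k)) := by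
  unfold gridWeight
  push_cast
  have h : 1 + (τ * k) ^ 2 ≤ 2 * ((1 + (τ * j) ^ 2) + (1 + (τ * (j + k)) ^ 2)) := by
    nlinarith [sq_nonneg (τ * j + τ * (j + k))]
  have hk : (0 : ℝ) < 1 + (τ * k) ^ 2 := by positivity
  have hj : (0 : ℝ) < 1 + (τ * j) ^ 2 := by positivity
  have hjk : (0 : ℝ) < 1 + (τ * (j + k)) ^ 2 := by positivity
  generalize 1 + (τ * (k : ℝ)) ^ 2 = c at *
  generalize 1 + (τ * (j : ℝ)) ^ 2 = a at *
  generalize 1 + (τ * ((j : ℝ) + k)) ^ 2 = b at *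
  have e : 2 * (1 / c) * (1 / a + 1 / b) = 2 * (a + b) / (c * (a * b)) := by
    field_simp
    ring
  rw [e, one_div_mul_one_div, div_le_div_iff₀ (by positivity) (by positivity)]
  nlinarith [mul_le_mul_of_nonneg_left h (mul_pos hj hjk).le]

lemma summable_of_abs_le_gridWeight (hτ : 0 < τ) (hx : ∀ k, |x k| ≤ A * gridWeight τ k) :
    Summable x :=
  Summable.of_norm_bounded ((summable_gridWeight hτ).mul_left A) hx

lemma hasSum_gridWeight_bound (hτ : 0 < τ) (k : ℤ) :
    HasSum (fun j => 2 * gridWeight τ k * (gridWeight τ j + gridWeight τ (j + k)))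
      (2 * gridWeight τ k * (∑' j, gridWeight τ j + ∑' j, gridWeight τ j)) := by
  have h := (summable_gridWeight hτ).hasSum
  exact (h.add ((Equiv.addRight k).hasSum_iff.2 h)).mul_left _

lemma abs_mul_shift_le (hx : ∀ k, |x k| ≤ A * gridWeight τ k)
    (hy : ∀ k, |y k| ≤ B * gridWeight τ k) (k j : ℤ) : |x j * y (j + k)| ≤
      A * B * (2 * gridWeight τ k * (gridWeight τ j + gridWeight τ (j + k))) := by
  have hA : 0 ≤ A := by
    have := (abs_nonneg _).trans (hx 0)
    rwa [gridWeight_zero, mul_one] at this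
  have hB : 0 ≤ B := by
    have := (abs_nonneg _).trans (hy 0)
    rwa [gridWeight_zero, mul_one] at this
  calc _ ≤ (A * gridWeight τ j) * (B * gridWeight τ (j + k)) := by
        rw [abs_mul]
        exact mul_le_mul (hx _) (hy _) (abs_nonneg _) ((abs_nonneg _).trans (hx _))
    _ = A * B * (gridWeight τ j * gridWeight τ (j + k)) := by ring
    _ ≤ _ := by
      exact mul_le_mul_of_nonneg_left (gridWeight_mul_gridWeight_le τ j k) (mul_nonneg hA hB)

lemma summable_mul_shift (hτ : 0 < τ) (hx : ∀ k, |x k| ≤ A * gridWeight τ k)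
    (hy : ∀ k, |y k| ≤ B * gridWeight τ k) (k : ℤ) : Summable fun j => x j * y (j + k) :=
  Summable.of_norm_bounded ((hasSum_gridWeight_bound hτ k).mul_left (A * B)).summable
    (abs_mul_shift_le hx hy k)

lemma abs_gridCorr_le (hτ : 0 < τ) (hx : ∀ k, |x k| ≤ A * gridWeight τ k)
    (hy : ∀ k, |y k| ≤ B * gridWeight τ k) (k : ℤ) :
    |gridCorr x y k| ≤ 16 * (A * B) * (1 + 1 / τ) * gridWeight τ k := by
  have hAB : 0 ≤ A * B := by
    have h1 := (abs_nonneg _).trans (hx 0)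
    have h2 := (abs_nonneg _).trans (hy 0)
    rw [gridWeight_zero, mul_one] at h1 h2
    positivity
  have h := tsum_of_norm_bounded (f := fun j => x j * y (j + k))
    ((hasSum_gridWeight_bound hτ k).mul_left (A * B)) (abs_mul_shift_le hx hy k)
  refine h.trans ?_
  have hw := gridWeight_pos τ k
  calc _ = A * B * (4 * gridWeight τ k) * ∑' j, gridWeight τ j := by ring
    _ ≤ A * B * (4 * gridWeight τ k) * (4 * (1 + 1 / τ)) := by
        gcongr
        exact tsum_gridWeight_le hτ
    _ = _ := by ring

lemma gridCorr_self_zero (x : ℤ → ℝ) : gridCorr x x 0 = ∑' j, x j ^ 2 := by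
  simp [gridCorr, sq]

/-- If `x` is odd and `y` is even then their correlation vanishes at the origin. -/
lemma tsum_mul_eq_zero_of_odd_of_even (hx : ∀ j, x (-j) = - x j) (hy : ∀ j, y (-j) = y j) :
    ∑' j, x j * y j = 0 := by
  have h := (Equiv.neg ℤ).tsum_eq fun j => x j * y j
  simp only [Equiv.neg_apply, hx, hy, neg_mul, tsum_neg] at h
  linarith

lemma hasSum_sub_shift_sq (hτ : 0 < τ) (hx : ∀ k, |x k| ≤ A * gridWeight τ k) {r : ℝ}
    (hr : r ^ 2 = 1) (k : ℤ) : HasSum (fun j => (x j - r * x (j + k)) ^ 2)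
      (2 * (gridCorr x x 0 - r * gridCorr x x k)) := by
  have h0 : HasSum (fun j => x j * x j) (gridCorr x x 0) := by
    have := (summable_mul_shift hτ hx hx 0).hasSum
    simpa [gridCorr] using this
  have h1 : HasSum (fun j => x (j + k) * x (j + k)) (gridCorr x x 0) :=
    (Equiv.addRight k).hasSum_iff.2 h0
  have h2 : HasSum (fun j => x j * x (j + k)) (gridCorr x x k) :=
    (summable_mul_shift hτ hx hx k).hasSum
  have e : (fun j => (x j - r * x (j + k)) ^ 2) =
      fun j => x j * x j + x (j + k) * x (j + k) - 2 * r * (x j * x (j + k)) := by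
    funext j
    linear_combination x (j + k) ^ 2 * hr
  have e' : 2 * (gridCorr x x 0 - r * gridCorr x x k) =
      gridCorr x x 0 + gridCorr x x 0 - 2 * r * gridCorr x x k := by ring
  rw [e, e']
  exact (h0.add h1).sub (h2.mul_left (2 * r))

lemma gridCorr_zero_sub_double_le (hτ : 0 < τ) (hx : ∀ k, |x k| ≤ A * gridWeight τ k) (k : ℤ) :
    gridCorr x x 0 - gridCorr x x (2 * k) ≤ 4 * (gridCorr x x 0 - |gridCorr x x k|) := by
  obtain ⟨r, hr, hrk⟩ : ∃ r : ℝ, r ^ 2 = 1 ∧ |gridCorr x x k| = r * gridCorr x x k := by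
    rcases abs_choice (gridCorr x x k) with h | h
    · exact ⟨1, by norm_num, by linarith⟩
    · exact ⟨-1, by norm_num, by linarith⟩
  rw [hrk]
  have h1 := hasSum_sub_shift_sq hτ hx hr k
  have h2 := hasSum_sub_shift_sq hτ hx (one_pow 2) (2 * k)
  have h3 := (Equiv.addRight k).hasSum_iff.2 h1
  have := hasSum_le (fun j => ?_) h2 ((h1.add h3).mul_left 2)
  · linarith
  · simp only [Function.comp_apply, Equiv.coe_addRight]
    rw [show j + k + k = j + 2 * k by ring]
    have e : x j - 1 * x (j + 2 * k) =
        (x j - r * x (j + k)) + r * (x (j + k) - r * x (j + 2 * k)) := by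
      linear_combination x (j + 2 * k) * hr
    rw [e]
    have : (r * (x (j + k) - r * x (j + 2 * k))) ^ 2 = (x (j + k) - r * x (j + 2 * k)) ^ 2 := by
      rw [mul_pow, hr, one_mul]
    nlinarith [sq_nonneg ((x j - r * x (j + k)) - r * (x (j + k) - r * x (j + 2 * k)))]

/-- A quantitative form of the fact that an autocorrelation has a strict maximum at the origin. -/
lemma abs_gridCorr_self_le (hτ : 0 < τ) (hx : ∀ k, |x k| ≤ A * gridWeight τ k) (hB : 1 ≤ B)
    (hxB : ∀ k, |gridCorr x x k| ≤ B * gridCorr x x 0 * gridWeight τ k) (k : ℤ) :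
    |gridCorr x x k| ≤ gridCorr x x 0 * (1 - 1 / (16 * B) * min 1 ((τ * k) ^ 2)) := by
  have hM : 0 ≤ gridCorr x x 0 := by
    rw [gridCorr_self_zero]
    exact tsum_nonneg fun j => sq_nonneg _
  set M := gridCorr x x 0 with hMdef
  have hiter : ∀ (n : ℕ) (k : ℤ), 2 * B ≤ 4 ^ n * (τ * k) ^ 2 →
      M ≤ 2 * 4 ^ n * (M - |gridCorr x x k|) := by
    intro n
    induction n with
    | zero =>
      intro k hk
      have h1 : B * M * gridWeight τ k ≤ M / 2 := by
        rw [gridWeight, mul_one_div, div_le_div_iff₀ (by positivity) two_pos]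
        nlinarith
      have := hxB k
      simp only [pow_zero, mul_one]
      linarith
    | succ n ih =>
      intro k hk
      have h1 := ih (2 * k) (by push_cast; rw [pow_succ] at hk; linarith)
      have h2 := gridCorr_zero_sub_double_le hτ hx k
      have h3 := le_abs_self (gridCorr x x (2 * k))
      calc M ≤ 2 * 4 ^ n * (M - |gridCorr x x (2 * k)|) := h1
        _ ≤ 2 * 4 ^ n * (4 * (M - |gridCorr x x k|)) := by
            gcongr
            linarith
        _ = _ := by ring
  rcases eq_or_ne k 0 with rfl | hk
  · simp [← hMdef, abs_of_nonneg hM]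
  have ht : 0 < (τ * k) ^ 2 := by positivity
  rcases le_or_gt (2 * B) ((τ * k) ^ 2) with hfar | hnear
  · have h1 := hiter 0 k (by simpa using hfar)
    rw [min_eq_left (by linarith), mul_one]
    have h2 : M * (1 / (16 * B)) ≤ M * (1 / 2) := by
      gcongr
      linarith
    simp only [pow_zero, mul_one] at h1
    linarith
  · obtain ⟨n, hn1, hn2⟩ := exists_nat_pow_near (x := 2 * B / (τ * k) ^ 2) (y := (4 : ℝ))
      ((one_le_div ht).2 hnear.le) (by norm_num)
    rw [le_div_iff₀ ht] at hn1
    rw [div_lt_iff₀ ht] at hn2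
    have h1 := hiter (n + 1) k hn2.le
    have h2 : 0 ≤ M - |gridCorr x x k| := by
      by_contra! h
      nlinarith [show (0 : ℝ) < 4 ^ (n + 1) by positivity]
    have h3 : M * (τ * k) ^ 2 ≤ 16 * B * (M - |gridCorr x x k|) := by
      calc _ ≤ 2 * 4 ^ (n + 1) * (M - |gridCorr x x k|) * (τ * k) ^ 2 := by gcongr
        _ = 8 * (4 ^ n * (τ * k) ^ 2) * (M - |gridCorr x x k|) := by ring
        _ ≤ 8 * (2 * B) * (M - |gridCorr x x k|) := by gcongr
        _ = _ := by ring
    have h4 : M * (1 / (16 * B) * min 1 ((τ * k) ^ 2)) ≤ M - |gridCorr x x k| := by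
      calc _ ≤ M * (1 / (16 * B) * (τ * k) ^ 2) := by
            gcongr
            exact min_le_right _ _
        _ = M * (τ * k) ^ 2 / (16 * B) := by ring
        _ ≤ _ := by
            rw [div_le_iff₀ (by positivity)]
            linarith
    linarith

/-- A sequence annihilated by convolution with the even sequence `y` is annihilated by all
correlations with `y`. -/
lemma tsum_gridCorr_mul_eq_zero {h : ℤ → ℝ} (hx : Summable x) (hy : ∀ k, |y k| ≤ B)
    (hyeven : ∀ k, y (-k) = y k) (hh : Summable h) (hyh : ∀ k, ∑' j, y (k - j) * h j = 0) (n : ℤ) :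
    ∑' k, gridCorr x y (k - n) * h k = 0 := by
  have hs : Summable (Function.uncurry fun k j => x j * y (j + (k - n)) * h k) := by
    refine Summable.of_norm_bounded
      (g := fun q : ℤ × ℤ => B * (|h q.1| * |x q.2|)) ?_ fun q => ?_
    · exact (Summable.mul_of_nonneg hh.abs hx.abs (fun _ => abs_nonneg _)
        fun _ => abs_nonneg _).mul_left B
    · simp only [Function.uncurry, norm_mul, Real.norm_eq_abs]
      calc |x q.2| * |y (q.2 + (q.1 - n))| * |h q.1| ≤ |x q.2| * B * |h q.1| := by
            gcongr
            exact hy _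
        _ = _ := by ring
  calc _ = ∑' k, ∑' j, x j * y (j + (k - n)) * h k := by
        refine tsum_congr fun k => ?_
        rw [gridCorr, tsum_mul_right]
    _ = ∑' j, ∑' k, x j * y (j + (k - n)) * h k := hs.tsum_comm.symm
    _ = ∑' j : ℤ, 0 := by
        refine tsum_congr fun j => ?_
        rw [← mul_zero (x j), ← hyh (n - j), ← tsum_mul_left]
        refine tsum_congr fun k => ?_
        rw [← hyeven, mul_assoc]
        congr 3
        ring
    _ = 0 := tsum_zero

/-- Annihilation of `h` by all translates of `x` passes to bounded combinations of translates. -/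
lemma tsum_tsum_mul_eq_zero {h a : ℤ → ℝ} {D : ℝ} (hx : Summable x) (hh : Summable h)
    (ha : ∀ n, |a n| ≤ D) (hxh : ∀ n, ∑' k, x (k - n) * h k = 0) :
    ∑' k, (∑' n, a n * x (k - n)) * h k = 0 := by
  have hs : Summable (Function.uncurry fun k n => a n * x (k - n) * h k) := by
    have hinj : Function.Injective fun q : ℤ × ℤ => (q.1, q.1 - q.2) := by
      rintro ⟨k, n⟩ ⟨k', n'⟩ hq
      simp only [Prod.mk.injEq] at hq ⊢
      omega
    have h1 := ((Summable.mul_of_nonneg hh.abs hx.abs (fun _ => abs_nonneg _)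
        fun _ => abs_nonneg _).mul_left D).comp_injective hinj
    refine Summable.of_norm_bounded h1 fun q => ?_
    simp only [Function.uncurry, norm_mul, Real.norm_eq_abs, Function.comp_apply]
    calc |a q.2| * |x (q.1 - q.2)| * |h q.1| ≤ D * |x (q.1 - q.2)| * |h q.1| := by
          gcongr
          exact ha _
      _ = _ := by ring
  calc _ = ∑' k, ∑' n, a n * x (k - n) * h k := tsum_congr fun k => tsum_mul_right.symm
    _ = ∑' n, ∑' k, a n * x (k - n) * h k := hs.tsum_comm.symm
    _ = ∑' n : ℤ, 0 := by
        refine tsum_congr fun n => ?_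
        simp_rw [mul_assoc]
        rw [tsum_mul_left, hxh, mul_zero]
    _ = 0 := tsum_zero

/-- A lower bound for a sum over grid points, from a lower bound on an interval. -/
lemma le_tsum_of_le_on_interval {F : ℤ → ℝ} (hF : Summable F) (hF0 : ∀ j, 0 ≤ F j)
    {a r m : ℝ} (hm : 0 ≤ m) (hτ : 0 < τ) (hτr : 2 * τ ≤ r)
    (hmF : ∀ j : ℤ, a ≤ τ * j → τ * j ≤ a + r → m ≤ F j) :
    m * r / (r + 2) * (1 + 1 / τ) ≤ ∑' j, F j := by
  have hr : 0 < r := by linarith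
  set I := Finset.Icc ⌈a / τ⌉ ⌊(a + r) / τ⌋
  have hcard : r / (2 * τ) ≤ (I.card : ℝ) := by
    have h1 := Int.ceil_lt_add_one (a / τ)
    have h2 := Int.lt_floor_add_one ((a + r) / τ)
    have h3 : ((⌊(a + r) / τ⌋ + 1 - ⌈a / τ⌉ : ℤ) : ℝ) ≤ I.card := by
      rw [Int.card_Icc]
      exact_mod_cast Int.self_le_toNat _
    push_cast at h3
    have h4 : (a + r) / τ = a / τ + 2 * (r / (2 * τ)) := by
      field_simp
    have h5 : 1 ≤ r / (2 * τ) := (one_le_div (by positivity)).2 hτr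
    linarith
  calc _ ≤ m * (r / (2 * τ)) := by
        rw [mul_div_assoc, mul_assoc]
        gcongr
        have : 1 + 1 / τ = (τ + 1) / τ := by field_simp
        rw [this, div_mul_div_comm, div_le_div_iff₀ (by positivity) (by positivity)]
        nlinarith [mul_pos hr hτ]
    _ ≤ m * I.card := by gcongr
    _ = ∑ j ∈ I, m := by rw [Finset.sum_const, nsmul_eq_mul, mul_comm]
    _ ≤ ∑ j ∈ I, F j := by
        refine Finset.sum_le_sum fun j hj => ?_
        rw [Finset.mem_Icc, Int.ceil_le, Int.le_floor, div_le_iff₀ hτ, le_div_iff₀ hτ] at hj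
        exact hmF j (by linarith [hj.1]) (by linarith [hj.2])
    _ ≤ _ := hF.sum_le_tsum _ fun j _ => hF0 j

end Correlation

section Kernel

lemma abs_deriv_sub_le {f : ℝ → ℝ} (hf : Differentiable ℝ f) {D x : ℝ}
    (hD : ∀ y, |y - x| ≤ 1 → |deriv f y| ≤ D) {s : ℝ} (hs : |s| ≤ 1) :
    |f (x + s) - f x| ≤ D * |s| := by
  have h := (convex_Icc (x - 1) (x + 1)).norm_image_sub_le_of_norm_deriv_le (f := f) (C := D)
    (x := x) (y := x + s) (fun y _ => hf y)
    (fun y hy => hD y (abs_le.2 ⟨by linarith [hy.1], by linarith [hy.2]⟩))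
    ⟨by linarith, by linarith⟩ ⟨by linarith [(abs_le.1 hs).1], by linarith [(abs_le.1 hs).2]⟩
  simpa using h

/-- A second order Taylor estimate for a function whose second derivative is
`O(1 / (1 + t ^ 2))`. -/
lemma abs_taylor_le {f : ℝ → ℝ} (hf : Differentiable ℝ f) (hf' : Differentiable ℝ (deriv f)) {A : ℝ}
    (hA : ∀ t, |deriv (deriv f) t| ≤ A * (1 / (1 + t ^ 2))) (x : ℝ) {s : ℝ} (hs : |s| ≤ 1) :
    |f (x + s) - f x - s * deriv f x| ≤ 3 * A * s ^ 2 * (1 / (1 + x ^ 2)) := by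
  have hA0 : 0 ≤ A := by
    have := (abs_nonneg _).trans (hA 0)
    simpa using this
  have h2 (y : ℝ) (hy : |y - x| ≤ 1) : |deriv (deriv f) y| ≤ 3 * A * (1 / (1 + x ^ 2)) := by
    have := mul_le_mul_of_nonneg_left (one_div_one_add_sq_le hy) hA0
    linarith [hA y]
  have h1 (t : ℝ) (ht : |t| ≤ |s|) : |deriv f (x + t) - deriv f x| ≤
      3 * A * (1 / (1 + x ^ 2)) * |s| :=
    (abs_deriv_sub_le hf' h2 (ht.trans hs)).trans (by gcongr)
  let F : ℝ → ℝ := fun t => f (x + t) - t * deriv f x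
  have hF (t : ℝ) : HasDerivAt F (deriv f (x + t) - deriv f x) t := by
    have e1 := (hf (x + t)).hasDerivAt.comp_const_add x t
    have e2 := (hasDerivAt_id t).mul_const (deriv f x)
    rw [one_mul] at e2
    exact e1.sub e2
  have h := (convex_Icc (-|s|) |s|).norm_image_sub_le_of_norm_hasDerivWithin_le (f := F)
    (x := 0) (y := s) (fun t _ => (hF t).hasDerivWithinAt)
    (fun t ht => h1 t (abs_le.2 ht)) ⟨by simp, by simp⟩ ⟨neg_abs_le s, le_abs_self s⟩
  have e : F s - F 0 = f (x + s) - f x - s * deriv f x := by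
    simp only [F, add_zero, zero_mul, sub_zero]
    ring
  rw [e, sub_zero, Real.norm_eq_abs, Real.norm_eq_abs] at h
  calc _ ≤ _ := h
    _ = 3 * A * (1 / (1 + x ^ 2)) * |s| ^ 2 := by ring
    _ = _ := by rw [sq_abs]; ring

/-- A continuous function which does not vanish at `x` is bounded below on an interval. -/
lemma exists_le_sq_on_Icc {f : ℝ → ℝ} (hf : Continuous f) {x : ℝ} (hx : f x ≠ 0) :
    ∃ r : ℝ, 0 < r ∧ r ≤ 2 ∧ ∀ t, x ≤ t → t ≤ x + r → (f x) ^ 2 / 2 ≤ f t ^ 2 := by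
  have hlt : (f x) ^ 2 / 2 < f x ^ 2 := half_lt_self (by positivity)
  have h := (hf.pow 2).continuousAt.eventually (lt_mem_nhds hlt)
  obtain ⟨δ, hδ, hball⟩ := Metric.eventually_nhds_iff.1 h
  refine ⟨min 2 (δ / 2), by positivity, min_le_left _ _, fun t h1 h2 => (hball ?_).le⟩
  rw [Real.dist_eq, abs_of_nonneg (by linarith)]
  linarith [min_le_right 2 (δ / 2)]

lemma abs_inv_mul_le {A S M m w z : ℝ} (hm : 0 < m) (hS : 0 < S) (hM : m * S ≤ M) (hA : 0 ≤ A)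
    (hw : 0 ≤ w) (hz : |z| ≤ A * S * w) : |M⁻¹ * z| ≤ A / m * w := by
  have hM0 : 0 < M := (mul_pos hm hS).trans_le hM
  rw [abs_mul, abs_of_pos (inv_pos.2 hM0), inv_mul_le_iff₀ hM0]
  calc |z| ≤ A * S * w := hz
    _ = (m * S) * (A / m * w) := by field_simp
    _ ≤ _ := by gcongr

lemma abs_gridCorr_taylor_le {τ A B : ℝ} {x y y₁ : ℤ → ℝ} (hτ : 0 < τ)
    (hx : ∀ k, |x k| ≤ A * gridWeight τ k) (hy : ∀ k, |y k| ≤ A * gridWeight τ k)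
    (hy₁ : ∀ k, |y₁ k| ≤ A * gridWeight τ k) (d s : ℤ)
    (htaylor : ∀ j, |y (j + s) - y j - τ * s * y₁ j| ≤ B * gridWeight τ j) :
    |gridCorr x y (d + s) - gridCorr x y d - τ * s * gridCorr x y₁ d| ≤
      16 * (A * B) * (1 + 1 / τ) * gridWeight τ d := by
  have s1 := summable_mul_shift hτ hx hy (d + s)
  have s2 := summable_mul_shift hτ hx hy d
  have s3 := (summable_mul_shift hτ hx hy₁ d).mul_left (τ * s)
  have e : gridCorr x y (d + s) - gridCorr x y d - τ * s * gridCorr x y₁ d =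
      gridCorr x (fun j => y (j + s) - y j - τ * s * y₁ j) d := by
    unfold gridCorr
    rw [← tsum_mul_left, ← s1.tsum_sub s2, ← (s1.sub s2).tsum_sub s3]
    refine tsum_congr fun j => ?_
    change _ = x j * (y (j + d + s) - y (j + d) - τ * s * y₁ (j + d))
    rw [add_assoc j d s]
    ring
  rw [e]
  exact abs_gridCorr_le hτ hx htaylor d

/-- For every grid step, the samples of an admissible kernel generate an interpolation kernel, with
constants independent of the step. -/
theorem IsAdmissibleKernel.exists_interpolationKernel {g : ℝ → ℝ} {ε β : ℝ}
    (hg : IsAdmissibleKernel g ε β) :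
    ∃ C c : ℝ, 0 < c ∧ ∀ τ : ℝ, 0 < τ → ∃ p p₁ e e₁ : ℤ → ℝ,
      InterpolationKernel τ C c p p₁ e e₁ ∧
      ∀ h : ℤ → ℝ, Summable h → (∀ k : ℤ, ∑' j : ℤ, g (τ * ((k : ℝ) - j)) * h j = 0) →
        ∀ n : ℤ, ∑' k, p (k - n) * h k = 0 ∧ ∑' k, e (k - n) * h k = 0 := by
  obtain ⟨A, hA0, hA, hA₁, hA₂⟩ : ∃ A : ℝ, 0 < A ∧ (∀ t, |g t| ≤ A * (1 / (1 + t ^ 2))) ∧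
      (∀ t, |deriv g t| ≤ A * (1 / (1 + t ^ 2))) ∧
      ∀ t, |deriv (deriv g) t| ≤ A * (1 / (1 + t ^ 2)) := by
    obtain ⟨D, hD, hDle⟩ := hg.global_decay
    have h0 := hDle 0
    have h1 := hDle 1
    have h2 := hDle 2
    have e0 : iteratedDeriv ((0 : Fin 4) : ℕ) g = g := iteratedDeriv_zero
    have e1 : iteratedDeriv ((1 : Fin 4) : ℕ) g = deriv g := iteratedDeriv_one
    have e2 : iteratedDeriv ((2 : Fin 4) : ℕ) g = deriv (deriv g) := by
      change iteratedDeriv (1 + 1) g = _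
      rw [iteratedDeriv_succ, iteratedDeriv_one]
    rw [e0] at h0
    rw [e1] at h1
    rw [e2] at h2
    have key {a t B : ℝ} (h : a ≤ B / (1 + t ^ 2)) (hB : B ≤ D 0 + D 1 + D 2) :
        a ≤ (D 0 + D 1 + D 2) * (1 / (1 + t ^ 2)) := by
      rw [mul_one_div]
      exact h.trans (by gcongr)
    exact ⟨D 0 + D 1 + D 2, by linarith [hD 0, hD 1, hD 2],
      fun t => key (h0 t) (by linarith [hD 0, hD 1, hD 2]),
      fun t => key (h1 t) (by linarith [hD 0, hD 1, hD 2]),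
      fun t => key (h2 t) (by linarith [hD 0, hD 1, hD 2])⟩
  have hdiff : Differentiable ℝ g := hg.smooth.differentiable (by norm_num)
  have hcd : ContDiff ℝ 2 (deriv g) := by
    have := hg.smooth
    rw [show (3 : WithTop ℕ∞) = 2 + 1 by norm_num, contDiff_succ_iff_deriv] at this
    exact this.2.2
  have hdiff' : Differentiable ℝ (deriv g) := hcd.differentiable (by norm_num)
  have hodd (t : ℝ) : deriv g (-t) = - deriv g t := by
    have h : (fun t => g (-t)) = g := funext hg.even
    have h' := deriv_comp_neg g t
    rw [h] at h'
    linarith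
  have hg0 : g 0 ≠ 0 := (hg.pos_near 0 (by simpa using hg.eps_pos.le)).ne'
  obtain ⟨x₁, hx₁⟩ : ∃ x, deriv g x ≠ 0 := by
    by_contra! h
    have h1 := hg.concave_near 0 (by simpa using hg.eps_pos.le)
    rw [show 2 = 1 + 1 from rfl, iteratedDeriv_succ, iteratedDeriv_one, show deriv g = fun _ => 0
      from funext h, deriv_const] at h1
    linarith [hg.beta_pos]
  obtain ⟨r, hr, hr2, hrle⟩ := exists_le_sq_on_Icc hdiff.continuous hg0
  obtain ⟨r₁, hr₁, hr₁2, hr₁le⟩ := exists_le_sq_on_Icc hdiff'.continuous hx₁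
  set m := min (g 0 ^ 2 / 2 * r / (r + 2)) (deriv g x₁ ^ 2 / 2 * r₁ / (r₁ + 2)) with hm
  have hm0 : 0 < m := by positivity
  set B := 48 * A ^ 2 / m with hB
  have hB0 : 0 < B := by positivity
  set τ₀ := r₁ / 2 with hτ₀
  have hτ₀pos : 0 < τ₀ := by positivity
  have hτ₀1 : τ₀ ≤ 1 := by linarith
  have hτ₀sq : τ₀ ^ 2 ≤ 1 := pow_le_one₀ hτ₀pos.le hτ₀1
  refine ⟨4 * (B + 1) / τ₀ ^ 2, 1 / (16 * (B + 1)), by positivity, fun τ hτ => ?_⟩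
  have hBC : B + 1 ≤ 4 * (B + 1) / τ₀ ^ 2 := by
    rw [le_div_iff₀ (by positivity)]
    nlinarith
  have hS : 0 < 1 + 1 / τ := by positivity
  set f : ℤ → ℝ := fun j => g (τ * j) with hf
  set f₁ : ℤ → ℝ := fun j => deriv g (τ * j) with hf₁
  have hfA : ∀ k, |f k| ≤ A * gridWeight τ k := fun k => hA _
  have hf₁A : ∀ k, |f₁ k| ≤ A * gridWeight τ k := fun k => hA₁ _
  have hfeven (k : ℤ) : f (-k) = f k := by simp [hf, hg.even]
  have hf₁odd (k : ℤ) : f₁ (-k) = - f₁ k := by simp [hf₁, hodd]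
  have hft (s : ℤ) (hs : |τ * s| ≤ 1) (j : ℤ) :
      |f (j + s) - f j - τ * s * f₁ j| ≤ (3 * A * (τ * s) ^ 2) * gridWeight τ j := by
    have := abs_taylor_le hdiff hdiff' hA₂ (τ * j) hs
    rw [← mul_add] at this
    simp only [hf, hf₁]
    push_cast
    exact this
  have hsq {x : ℤ → ℝ} (hx : ∀ k, |x k| ≤ A * gridWeight τ k) : Summable fun j => x j ^ 2 := by
    simpa [sq] using summable_mul_shift hτ hx hx 0
  set M := gridCorr f f 0 with hM
  have hMle : m * (1 + 1 / τ) ≤ M := by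
    have h1 : m * (1 + 1 / τ) ≤ g 0 ^ 2 / 2 * r / (r + 2) * (1 + 1 / τ) := by
      gcongr
      exact min_le_left _ _
    refine h1.trans ?_
    rw [hM, gridCorr_self_zero]
    rcases le_or_gt (2 * τ) r with hτr | hτr
    · exact le_tsum_of_le_on_interval (hsq hfA) (fun j => sq_nonneg _) (a := 0) (by positivity)
        hτ hτr fun j ha hb => hrle _ ha hb
    · have h2 : g 0 ^ 2 ≤ ∑' j, f j ^ 2 := by
        have := (hsq hfA).le_tsum 0 fun j _ => sq_nonneg _
        simpa [hf] using this
      refine le_trans ?_ h2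
      have h3 : 1 + 1 / τ ≤ (r + 2) / r := by
        rw [add_div, div_self hr.ne']
        have : 1 / τ ≤ 2 / r := by
          rw [div_le_div_iff₀ hτ hr]
          linarith
        linarith
      calc _ ≤ g 0 ^ 2 / 2 * r / (r + 2) * ((r + 2) / r) := by gcongr
        _ = g 0 ^ 2 / 2 := by field_simp
        _ ≤ _ := half_le_self (sq_nonneg _)
  have hMpos : 0 < M := (mul_pos hm0 hS).trans_le hMle
  have hbound {x y : ℤ → ℝ} (hx : ∀ k, |x k| ≤ A * gridWeight τ k)
      (hy : ∀ k, |y k| ≤ A * gridWeight τ k) {M' : ℝ} (hM' : m * (1 + 1 / τ) ≤ M') (k : ℤ) :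
      |M'⁻¹ * gridCorr x y k| ≤ B * gridWeight τ k := by
    refine abs_inv_mul_le hm0 hS hM' (by positivity) (gridWeight_pos τ k).le
      ((abs_gridCorr_le hτ hx hy k).trans ?_)
    have := gridWeight_pos τ k
    gcongr
    · norm_num
    · exact (sq A).ge
  have htaylor {x : ℤ → ℝ} (hx : ∀ k, |x k| ≤ A * gridWeight τ k) {M' : ℝ}
      (hM' : m * (1 + 1 / τ) ≤ M') (d s : ℤ) (hs : |τ * s| ≤ 1) :
      |M'⁻¹ * gridCorr x f (d + s) - M'⁻¹ * gridCorr x f d - τ * s * (M'⁻¹ * gridCorr x f₁ d)| ≤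
        B * (τ * s) ^ 2 * gridWeight τ d := by
    have e : M'⁻¹ * gridCorr x f (d + s) - M'⁻¹ * gridCorr x f d -
        τ * s * (M'⁻¹ * gridCorr x f₁ d) =
        M'⁻¹ * (gridCorr x f (d + s) - gridCorr x f d - τ * s * gridCorr x f₁ d) := by ring
    rw [e, mul_assoc B]
    refine abs_inv_mul_le hm0 hS hM' (by positivity)
      (mul_nonneg (sq_nonneg _) (gridWeight_pos τ d).le)
      ((abs_gridCorr_taylor_le hτ hx hfA hf₁A d s (hft s hs)).trans (le_of_eq ?_))
    ring
  have hwC {z w : ℝ} (hw : 0 ≤ w) (h : z ≤ B * w) : z ≤ 4 * (B + 1) / τ₀ ^ 2 * w := by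
    refine h.trans ?_
    gcongr
    linarith
  have hann {x : ℤ → ℝ} (hx : ∀ k, |x k| ≤ A * gridWeight τ k) (M' : ℝ) (h : ℤ → ℝ)
      (hh : Summable h) (hgh : ∀ k : ℤ, ∑' j : ℤ, g (τ * ((k : ℝ) - j)) * h j = 0) (n : ℤ) :
      ∑' k, M'⁻¹ * gridCorr x f (k - n) * h k = 0 := by
    simp_rw [mul_assoc]
    rw [tsum_mul_left, tsum_gridCorr_mul_eq_zero (summable_of_abs_le_gridWeight hτ hx)
      (fun k => (hfA k).trans (mul_le_of_le_one_right hA0.le (gridWeight_le_one τ k))) hfeven hh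
      (fun k => by simpa [hf] using hgh k), mul_zero]
  have hp0 : M⁻¹ * gridCorr f f 0 = 1 := inv_mul_cancel₀ hMpos.ne'
  have hB1 : 1 ≤ B := by
    have := hbound hfA hfA hMle 0
    rw [hp0, gridWeight_zero] at this
    simpa using this
  have hgap (s : ℤ) : |M⁻¹ * gridCorr f f s| ≤ 1 - 1 / (16 * (B + 1)) * min 1 ((τ * s) ^ 2) := by
    have h1 (k : ℤ) : |gridCorr f f k| ≤ B * M * gridWeight τ k := by
      have := hbound hfA hfA hMle k
      rw [abs_mul, abs_of_pos (inv_pos.2 hMpos), inv_mul_le_iff₀ hMpos] at this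
      linarith
    have h2 := abs_gridCorr_self_le hτ hfA hB1 h1 s
    rw [abs_mul, abs_of_pos (inv_pos.2 hMpos), inv_mul_le_iff₀ hMpos]
    refine h2.trans ?_
    rw [← hM]
    gcongr
    linarith
  rcases le_or_gt τ τ₀ with hτle | hτgt
  · set M₁ := gridCorr f₁ f₁ 0 with hM₁
    have hM₁le : m * (1 + 1 / τ) ≤ M₁ := by
      have h1 : m * (1 + 1 / τ) ≤ deriv g x₁ ^ 2 / 2 * r₁ / (r₁ + 2) * (1 + 1 / τ) := by
        gcongr
        exact min_le_right _ _
      refine h1.trans ?_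
      rw [hM₁, gridCorr_self_zero]
      exact le_tsum_of_le_on_interval (hsq hf₁A) (fun j => sq_nonneg _) (a := x₁) (by positivity)
        hτ (by linarith) fun j ha hb => hr₁le _ ha hb
    have hM₁pos : 0 < M₁ := (mul_pos hm0 hS).trans_le hM₁le
    have hcross : ∑' j, f₁ j * f j = 0 := tsum_mul_eq_zero_of_odd_of_even hf₁odd hfeven
    refine ⟨fun k => M⁻¹ * gridCorr f f k, fun k => M⁻¹ * gridCorr f f₁ k,
      fun k => M₁⁻¹ * gridCorr f₁ f k, fun k => M₁⁻¹ * gridCorr f₁ f₁ k, ?_,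
      fun h hh hgh n => ⟨hann hfA M h hh hgh n, hann hf₁A M₁ h hh hgh n⟩⟩
    exact
      { abs_p_le := fun k => hwC (gridWeight_pos τ k).le (hbound hfA hfA hMle k)
        abs_p₁_le := fun k => hwC (gridWeight_pos τ k).le (hbound hfA hf₁A hMle k)
        abs_e_le := fun k => hwC (gridWeight_pos τ k).le (hbound hf₁A hfA hM₁le k)
        abs_e₁_le := fun k => hwC (gridWeight_pos τ k).le (hbound hf₁A hf₁A hM₁le k)
        p_zero := hp0
        p₁_zero := by
          simp only [gridCorr, add_zero]
          simp_rw [mul_comm (f _)]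
          rw [hcross, mul_zero]
        e_zero := by
          simp only [gridCorr, add_zero]
          rw [hcross, mul_zero]
        e₁_zero := inv_mul_cancel₀ hM₁pos.ne'
        taylor_p := fun d s hs => by
          rw [mul_assoc (4 * (B + 1) / τ₀ ^ 2)]
          refine hwC (mul_nonneg (sq_nonneg _) (gridWeight_pos τ d).le) ?_
          rw [← mul_assoc B]
          exact htaylor hfA hMle d s hs
        taylor_e := fun d s hs => by
          rw [mul_assoc (4 * (B + 1) / τ₀ ^ 2)]
          refine hwC (mul_nonneg (sq_nonneg _) (gridWeight_pos τ d).le) ?_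
          rw [← mul_assoc B]
          exact htaylor hf₁A hM₁le d s hs
        gap := hgap }
  · have hstep (s : ℤ) (hs : s ≠ 0) : τ₀ ≤ |τ * s| := by
      rw [abs_mul, abs_of_pos hτ]
      have : (1 : ℝ) ≤ |(s : ℝ)| := by exact_mod_cast Int.one_le_abs hs
      nlinarith
    have hstep2 (s : ℤ) (hs : s ≠ 0) : τ₀ ^ 2 ≤ (τ * s) ^ 2 := by
      rw [← sq_abs (τ * s)]
      gcongr
      exact hstep s hs
    have hzero (k : ℤ) : |(0 : ℝ)| ≤ 4 * (B + 1) / τ₀ ^ 2 * gridWeight τ k := by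
      have := gridWeight_pos τ k
      rw [abs_zero]
      positivity
    refine ⟨fun k => M⁻¹ * gridCorr f f k, 0, 0, Pi.single 0 1, ?_,
      fun h hh hgh n => ⟨hann hfA M h hh hgh n, by simp⟩⟩
    exact
      { abs_p_le := fun k => hwC (gridWeight_pos τ k).le (hbound hfA hfA hMle k)
        abs_p₁_le := hzero
        abs_e_le := hzero
        abs_e₁_le := fun k => by
          rcases eq_or_ne k 0 with rfl | hk
          · rw [Pi.single_eq_same, gridWeight_zero, abs_one]
            linarith
          · rw [Pi.single_eq_of_ne hk]
            exact hzero k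
        p_zero := hp0
        p₁_zero := rfl
        e_zero := rfl
        e₁_zero := by simp
        taylor_p := fun d s hs => by
          have hd := gridWeight_pos τ d
          rcases eq_or_ne s 0 with rfl | hs0
          · simp
          have h1 := hbound hfA hfA hMle (d + s)
          have h2 := hbound hfA hfA hMle d
          have h3 := mul_le_mul_of_nonneg_left (gridWeight_add_le d hs) hB0.le
          have h4 := abs_sub (M⁻¹ * gridCorr f f (d + s)) (M⁻¹ * gridCorr f f d)
          have h5 : 1 ≤ (τ * s) ^ 2 / τ₀ ^ 2 := (one_le_div (by positivity)).2 (hstep2 s hs0)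
          simp only [Pi.zero_apply, mul_zero, sub_zero]
          calc _ ≤ 4 * (B + 1) * gridWeight τ d * 1 := by linarith
            _ ≤ 4 * (B + 1) * gridWeight τ d * ((τ * s) ^ 2 / τ₀ ^ 2) := by gcongr
            _ = _ := by ring
        taylor_e := fun d s hs => by
          have hd := gridWeight_pos τ d
          rcases eq_or_ne d 0 with rfl | hd0
          · rcases eq_or_ne s 0 with rfl | hs0
            · simp
            have h5 : 1 ≤ (τ * s) ^ 2 / τ₀ ^ 2 := (one_le_div (by positivity)).2 (hstep2 s hs0)
            simp only [Pi.zero_apply, Pi.single_eq_same, sub_zero, zero_sub, mul_one, abs_neg,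
              gridWeight_zero]
            calc _ ≤ 1 := hs
              _ ≤ (τ * s) ^ 2 / τ₀ ^ 2 := h5
              _ ≤ 4 * (B + 1) * ((τ * s) ^ 2 / τ₀ ^ 2) :=
                  le_mul_of_one_le_left (by positivity) (by linarith)
              _ = _ := by ring
          · simp only [Pi.zero_apply, Pi.single_eq_of_ne hd0, sub_zero, mul_zero, abs_zero]
            positivity
        gap := hgap }

end Kernel

/-- A dual certificate for the sign pattern of `x` forces a feasible competitor whose `ℓ¹` norm is
at most that of `x` to vanish off `K`. -/
lemma eq_zero_off_of_certificate {x z q : ℤ → ℝ} {K : Set ℤ} (hx : Summable x) (hz : Summable z)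
    (hxK : ∀ k ∉ K, x k = 0) (hq : ∀ k ∈ K, q k = SignType.sign (x k))
    (hqlt : ∀ k ∉ K, |q k| < 1) (hqz : ∑' k, q k * (z k - x k) = 0)
    (hle : ∑' k, |z k| ≤ ∑' k, |x k|) : ∀ k ∉ K, z k = 0 := by
  have hq1 (k : ℤ) : |q k| ≤ 1 := by
    by_cases hk : k ∈ K
    · rw [hq k hk]
      rcases lt_trichotomy (x k) 0 with h | h | h <;> simp [h]
    · exact (hqlt k hk).le
  have hs {y : ℤ → ℝ} (hy : Summable y) : Summable fun k => q k * y k :=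
    Summable.of_norm_bounded hy.abs fun k => by
      rw [Real.norm_eq_abs, abs_mul]
      exact mul_le_of_le_one_left (abs_nonneg _) (hq1 k)
  have hxabs : ∑' k, |x k| = ∑' k, q k * x k := tsum_congr fun k => by
    by_cases hk : k ∈ K
    · rw [hq k hk, sign_mul_self]
    · simp [hxK k hk]
  have hqzx : ∑' k, q k * z k = ∑' k, q k * x k := by
    rw [← sub_eq_zero, ← (hs hz).tsum_sub (hs hx), ← hqz]
    exact tsum_congr fun k => (mul_sub _ _ _).symm
  have hnonneg (k : ℤ) : 0 ≤ |z k| - q k * z k := by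
    have : q k * z k ≤ |q k| * |z k| := by
      rw [← abs_mul]
      exact le_abs_self _
    nlinarith [hq1 k, abs_nonneg (z k)]
  have hsum := hz.abs.sub (hs hz)
  have hzero : ∑' k, (|z k| - q k * z k) = 0 := by
    refine le_antisymm ?_ (tsum_nonneg hnonneg)
    rw [hz.abs.tsum_sub (hs hz)]
    linarith
  intro k hk
  have h1 := congrFun ((hasSum_zero_iff_of_nonneg hnonneg).1 (hzero ▸ hsum.hasSum)) k
  simp only [Pi.zero_apply] at h1
  have : q k * z k ≤ |q k| * |z k| := by
    rw [← abs_mul]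
    exact le_abs_self _
  by_contra hne
  nlinarith [hqlt k hk, abs_pos.2 hne]

/-- Corollary 2.2 (exact recovery in the noiseless case): with `δ = 0` and no
noise, any ℓ¹ minimizer among summable solutions of `y = g_σ ∗ x̃` equals the
underlying spike train `x` (in particular the minimizer is unique). -/
theorem exact_recovery_noiseless
    (g : ℝ → ℝ) (ε β : ℝ) (hg : IsAdmissibleKernel g ε β) :
    ∃ ν : ℝ, ν > max ε β ∧
      ∀ (N : ℕ), 1 ≤ N → ∀ σ : ℝ, 0 < σ →
      ∀ x : ℤ → ℝ, Summable x →
      -- minimal separation condition on the support `K` of `x`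
      (∀ ki ∈ Function.support x, ∀ kj ∈ Function.support x, ki ≠ kj →
        (N : ℝ) * ν * σ ≤ |(ki : ℝ) - (kj : ℝ)|) →
      ∀ y : ℤ → ℝ,
        (∀ k : ℤ, y k = ∑' j : ℤ, g (((k : ℝ) - (j : ℝ)) / (σ * N)) * x j) →
      ∀ xhat : ℤ → ℝ, Summable xhat →
        -- `x̂` satisfies the noiseless data constraint `y = g_σ ∗ x̂`
        (∀ k : ℤ, y k = ∑' j : ℤ, g (((k : ℝ) - (j : ℝ)) / (σ * N)) * xhat j) →
        -- `x̂` minimizes the ℓ¹ norm among all summable solutions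
        (∀ xt : ℤ → ℝ, Summable xt →
          (∀ k : ℤ, y k = ∑' j : ℤ, g (((k : ℝ) - (j : ℝ)) / (σ * N)) * xt j) →
          (∑' k : ℤ, |xhat k|) ≤ (∑' k : ℤ, |xt k|)) →
      ∀ k : ℤ, xhat k = x k := by
  obtain ⟨C, c, hc, hker⟩ := hg.exists_interpolationKernel
  obtain ⟨ν₀, hν₀⟩ := InterpolationKernel.exists_certificate (C := C) hc
  refine ⟨max ν₀ (max ε β + 1), lt_max_of_lt_right (lt_add_one _), ?_⟩
  intro N hN σ hσ x hx hsep y hy xhat hxhat hyhat hmin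
  have hN0 : (0 : ℝ) < N := by exact_mod_cast hN
  have hσN : 0 < σ * N := mul_pos hσ hN0
  set τ := (σ * N)⁻¹ with hτdef
  have hτ : 0 < τ := inv_pos.2 hσN
  obtain ⟨p, p₁, e, e₁, hK, hann⟩ := hker τ hτ
  have hdiv (k j : ℤ) : ((k : ℝ) - j) / (σ * N) = τ * ((k : ℝ) - j) := by
    rw [hτdef, div_eq_inv_mul]
  simp_rw [hdiv] at hy hyhat
  have hsep' : ∀ m ∈ Function.support x, ∀ n ∈ Function.support x, m ≠ n →
      max ν₀ (max ε β + 1) ≤ |τ * ((m : ℝ) - n)| := by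
    intro m hm n hn hmn
    have := hsep m hm n hn hmn
    rw [abs_mul, abs_of_pos hτ, hτdef, le_inv_mul_iff₀ hσN]
    linarith
  obtain ⟨A, hA⟩ : ∃ A, ∀ t, |g t| ≤ A := by
    obtain ⟨D, hD, hDle⟩ := hg.global_decay
    refine ⟨D 0, fun t => (hDle 0 t).trans (div_le_self (hD 0).le ?_)⟩
    nlinarith [sq_nonneg t]
  have hs {z : ℤ → ℝ} (hz : Summable z) (k : ℤ) :
      Summable fun j : ℤ => g (τ * ((k : ℝ) - j)) * z j :=
    Summable.of_norm_bounded (hz.abs.mul_left A) fun j => by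
      rw [Real.norm_eq_abs, abs_mul]
      gcongr
      exact hA _
  have hh : Summable fun k => xhat k - x k := hxhat.sub hx
  have hgh (k : ℤ) : ∑' j : ℤ, g (τ * ((k : ℝ) - j)) * (xhat j - x j) = 0 := by
    rw [tsum_congr fun j : ℤ => mul_sub (g (τ * ((k : ℝ) - j))) (xhat j) (x j),
      (hs hxhat k).tsum_sub (hs hx k), ← hy, ← hyhat, sub_self]
  have hcert (u : ℤ → ℝ) (hu : ∀ m, |u m| ≤ 1) : ∃ q : ℤ → ℝ,
      (∀ m ∈ Function.support x, q m = u m) ∧ (∀ k ∉ Function.support x, |q k| < 1) ∧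
      ∑' k, q k * (xhat k - x k) = 0 := by
    obtain ⟨a, b, ha, hb, hq, hqlt⟩ := hν₀ _ (le_max_left _ _) τ hτ p p₁ e e₁ hK _ hsep' u hu
    refine ⟨_, hq, hqlt, ?_⟩
    have hp := summable_of_abs_le_gridWeight hτ hK.abs_p_le
    have he := summable_of_abs_le_gridWeight hτ hK.abs_e_le
    have hshift {z w : ℤ → ℝ} (hz : Summable z) (hw : ∀ n, |w n| ≤ 2) (k : ℤ) :
        Summable fun n => w n * z (k - n) :=
      Summable.of_norm_bounded ((hz.abs.comp_injective sub_right_injective).mul_left 2) fun n => by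
        rw [Real.norm_eq_abs, abs_mul]
        exact mul_le_mul_of_nonneg_right (hw n) (abs_nonneg _)
    have hbdd {z w : ℤ → ℝ} (hz : Summable z) (hw : ∀ n, |w n| ≤ 2) :
        Summable fun k => (∑' n, w n * z (k - n)) * (xhat k - x k) := by
      refine Summable.of_norm_bounded (hh.abs.mul_left (2 * ∑' n, |z n|)) fun k => ?_
      rw [Real.norm_eq_abs, abs_mul]
      gcongr
      have h1 : HasSum (fun n => |z (k - n)|) (∑' n, |z n|) :=
        (Equiv.subLeft k).hasSum_iff.2 hz.abs.hasSum
      refine tsum_of_norm_bounded (f := fun n => w n * z (k - n)) (h1.mul_left 2) fun n => ?_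
      rw [Real.norm_eq_abs, abs_mul]
      exact mul_le_mul_of_nonneg_right (hw n) (abs_nonneg _)
    have hsplit (k : ℤ) : (∑' n, (a n * p (k - n) + b n * e (k - n))) * (xhat k - x k) =
        (∑' n, a n * p (k - n)) * (xhat k - x k) + (∑' n, b n * e (k - n)) * (xhat k - x k) := by
      rw [(hshift hp ha k).tsum_add (hshift he hb k), add_mul]
    simp_rw [hsplit]
    rw [(hbdd hp ha).tsum_add (hbdd he hb),
      tsum_tsum_mul_eq_zero hp hh ha fun n => (hann _ hh hgh n).1,
      tsum_tsum_mul_eq_zero he hh hb fun n => (hann _ hh hgh n).2, add_zero]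
  have hoff : ∀ k ∉ Function.support x, xhat k = 0 := by
    obtain ⟨q, hq, hqlt, hqh⟩ := hcert (fun k => SignType.sign (x k)) fun k => by
      rcases lt_trichotomy (x k) 0 with h | h | h <;> simp [h]
    exact eq_zero_off_of_certificate hx hxhat (fun k => Function.notMem_support.1) hq hqlt hqh
      (hmin x hx (fun k => by simp_rw [hdiv]; exact hy k))
  obtain ⟨q, hq, -, hqh⟩ := hcert (fun k => SignType.sign (xhat k - x k)) fun k => by
    rcases lt_trichotomy (xhat k - x k) 0 with h | h | h <;> simp [h]
  have habs : ∑' k, |xhat k - x k| = 0 := by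
    rw [← hqh]
    refine tsum_congr fun k => ?_
    by_cases hk : k ∈ Function.support x
    · rw [hq k hk, sign_mul_self]
    · simp [hoff k hk, Function.notMem_support.1 hk]
  intro k
  have h1 := congrFun ((hasSum_zero_iff_of_nonneg fun k => abs_nonneg _).1
    (habs ▸ hh.abs.hasSum)) k
  exact sub_eq_zero.1 (abs_eq_zero.1 h1)
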